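/- For every integer n ≥ 0 and all integers 0 ≤ k ≤ n and 0 ≤ j ≤ n+1: ∫_{B₂} y·Q_n^k(x,y)·Q_{n+1}^j(x,y) dx dy = d_{k,n} if j = k+1, = c_{k,n} if j = k−1, and = 0 otherwise (i.e., the matrix A_{n,2} is tridiagonal-banded with entries c_{k,n} and d_{k,n}). -/

import Mathlib

open MeasureTheory Real Filter

/-- The Gegenbauer polynomials `C_n^λ`, defined by their triple recursion. -/
noncomputable def gegenbauer (lam : ℝ) : ℕ → ℝ → ℝ
  | 0, _ => 1
  | 1, t => 2 * lam * t
  | (n + 2), t =>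
      (2 * (((n : ℝ) + 1) + lam) / ((n : ℝ) + 2)) * t * gegenbauer lam (n + 1) t
        - ((((n : ℝ) + 1) + 2 * lam - 1) / ((n : ℝ) + 2)) * gegenbauer lam n t

/-- The open unit disk in `ℝ²`. -/
def unitDisk : Set (ℝ × ℝ) := {p | p.1 ^ 2 + p.2 ^ 2 < 1}

/-- The normalization constant `h_{k,n}`. -/
noncomputable def hConst (k n : ℕ) : ℝ :=
  Real.sqrt ((π / 4 ^ k) * (Nat.factorial (n + k + 1)) /
    (((n : ℝ) + 1) * (2 * (k : ℝ) + 1) * ((Nat.factorial k : ℝ)) ^ 2 *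
      (Nat.factorial (n - k) : ℝ)))

/-- The orthonormal polynomial basis `Q_n^k` on the unit disk. -/
noncomputable def Q2 (n k : ℕ) (x y : ℝ) : ℝ :=
  (1 / hConst k n) * gegenbauer ((k : ℝ) + 1) (n - k) x *
    (1 - x ^ 2) ^ ((k : ℝ) / 2) * gegenbauer (1 / 2) k (y / Real.sqrt (1 - x ^ 2))

/-- The recursion coefficient `a_{k,n}`. -/
noncomputable def aCoef (k n : ℤ) : ℝ :=
  (1 / 2) * Real.sqrt (((n : ℝ) - k + 1) * ((n : ℝ) + k + 2) /
    (((n : ℝ) + 1) * ((n : ℝ) + 2)))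

/-- The recursion coefficient `d_{k,n}`. -/
noncomputable def dCoef (k n : ℤ) : ℝ :=
  (((k : ℝ) + 1) / 2) * Real.sqrt (((n : ℝ) + k + 3) * ((n : ℝ) + k + 2) /
    ((2 * (k : ℝ) + 1) * (2 * (k : ℝ) + 3) * ((n : ℝ) + 1) * ((n : ℝ) + 2)))

/-- The recursion coefficient `c_{k,n}`. -/
noncomputable def cCoef (k n : ℤ) : ℝ :=
  -((k : ℝ) / 2) * Real.sqrt (((n : ℝ) - k + 1) * ((n : ℝ) - k + 2) /
    (((n : ℝ) + 1) * ((n : ℝ) + 2) * (2 * (k : ℝ) - 1) * (2 * (k : ℝ) + 1)))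

lemma gegenbauer_rec (lam : ℝ) (n : ℕ) (t : ℝ) :
    ((n : ℝ) + 2) * gegenbauer lam (n + 2) t =
      2 * ((n : ℝ) + 1 + lam) * t * gegenbauer lam (n + 1) t
        - ((n : ℝ) + 2 * lam) * gegenbauer lam n t := by
  have h : (n : ℝ) + 2 ≠ 0 := by positivity
  rw [gegenbauer]
  field_simp
  ring

lemma continuous_gegenbauer (lam : ℝ) : ∀ n, Continuous (gegenbauer lam n)
  | 0 => by
      have : gegenbauer lam 0 = fun _ => 1 := by ext; rw [gegenbauer]
      rw [this]; fun_prop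
  | 1 => by
      have : gegenbauer lam 1 = fun t => 2 * lam * t := by ext; rw [gegenbauer]
      rw [this]; fun_prop
  | (n + 2) => by
      have h0 := continuous_gegenbauer lam n
      have h1 := continuous_gegenbauer lam (n + 1)
      have : gegenbauer lam (n + 2) = fun t =>
          (2 * (((n : ℝ) + 1) + lam) / ((n : ℝ) + 2)) * t * gegenbauer lam (n + 1) t
            - ((((n : ℝ) + 1) + 2 * lam - 1) / ((n : ℝ) + 2)) * gegenbauer lam n t := by
        ext; rw [gegenbauer]
      rw [this]; fun_prop

/-- Two contiguous relations between the parameters `lam` and `lam + 1`. -/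
lemma gegenbauer_contiguous (lam t : ℝ) (n : ℕ) :
    ((n : ℝ) + 1 + 2 * lam) * gegenbauer lam (n + 1) t =
        2 * lam * (gegenbauer (lam + 1) (n + 1) t - t * gegenbauer (lam + 1) n t) ∧
      ((n : ℝ) + 2) * gegenbauer lam (n + 2) t =
        2 * lam * (t * gegenbauer (lam + 1) (n + 1) t - gegenbauer (lam + 1) n t) := by
  induction n with
  | zero =>
    have h := gegenbauer_rec lam 0 t
    constructor
    · simp only [gegenbauer]; push_cast; ring
    · rw [h]; simp only [gegenbauer]; push_cast; ring
  | succ n ih =>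
    obtain ⟨ha, hb⟩ := ih
    have hE := gegenbauer_rec (lam + 1) n t
    have hR := gegenbauer_rec lam (n + 1) t
    have hn : (n : ℝ) + 2 ≠ 0 := by positivity
    have ha' : ((n : ℝ) + 2 + 2 * lam) * gegenbauer lam (n + 2) t =
        2 * lam * (gegenbauer (lam + 1) (n + 2) t - t * gegenbauer (lam + 1) (n + 1) t) := by
      apply mul_left_cancel₀ hn
      linear_combination ((n : ℝ) + 2 + 2 * lam) * hb - 2 * lam * hE
    push_cast at hR ⊢
    constructor
    · linear_combination ha'
    · linear_combination hR + t * (ha' + hb) - ha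

lemma gegenbauer_param_succ (lam t : ℝ) (n : ℕ) :
    ((n : ℝ) + 2 + lam) * gegenbauer lam (n + 2) t =
      lam * (gegenbauer (lam + 1) (n + 2) t - gegenbauer (lam + 1) n t) := by
  have hb := (gegenbauer_contiguous lam t n).2
  have ha := (gegenbauer_contiguous lam t (n + 1)).1
  push_cast at ha
  linear_combination (ha + hb) / 2

lemma one_sub_sq_mul_gegenbauer (lam t : ℝ) (n : ℕ) :
    (1 - t ^ 2) * (2 * lam * gegenbauer (lam + 1) n t) =
      ((n : ℝ) + 1 + 2 * lam) * (t * gegenbauer lam (n + 1) t)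
        - ((n : ℝ) + 2) * gegenbauer lam (n + 2) t := by
  obtain ⟨ha, hb⟩ := gegenbauer_contiguous lam t n
  linear_combination hb - t * ha

lemma hasDerivAt_gegenbauer (lam t : ℝ) : ∀ n : ℕ,
    HasDerivAt (gegenbauer lam (n + 1)) (2 * lam * gegenbauer (lam + 1) n t) t
  | 0 => by
      have : gegenbauer lam (0 + 1) = fun t => 2 * lam * t := by ext; simp only [gegenbauer]
      rw [this]
      simpa [gegenbauer] using (hasDerivAt_id t).const_mul (2 * lam)
  | 1 => by
      have : gegenbauer lam (1 + 1) = fun t => 2 * lam * ((1 + lam) * t ^ 2) - lam := by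
        ext t; simp only [gegenbauer]; push_cast; ring
      rw [this]
      refine ((((hasDerivAt_pow 2 t).const_mul (1 + lam)).const_mul (2 * lam)).sub_const
        lam).congr_deriv ?_
      simp only [gegenbauer]; push_cast; ring
  | (n + 2) => by
      have h0 := hasDerivAt_gegenbauer lam t n
      have h1 := hasDerivAt_gegenbauer lam t (n + 1)
      have : gegenbauer lam (n + 2 + 1) = fun t =>
          (1 / ((n : ℝ) + 3)) * (2 * ((n : ℝ) + 2 + lam) * (t * gegenbauer lam (n + 1 + 1) t)
            - ((n : ℝ) + 1 + 2 * lam) * gegenbauer lam (n + 1) t) := by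
        ext t
        have h : (n : ℝ) + 3 ≠ 0 := by positivity
        have hR := gegenbauer_rec lam (n + 1) t
        push_cast at hR
        field_simp
        linear_combination hR
      rw [this]
      refine (((((hasDerivAt_id t).mul h1).const_mul (2 * ((n : ℝ) + 2 + lam))).sub
        (h0.const_mul ((n : ℝ) + 1 + 2 * lam))).const_mul (1 / ((n : ℝ) + 3))).congr_deriv ?_
      have h : (n : ℝ) + 3 ≠ 0 := by positivity
      have hi := gegenbauer_param_succ lam t n
      have hE := gegenbauer_rec (lam + 1) n t
      rw [one_div, inv_mul_eq_iff_eq_mul₀ h]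
      simp only [id]
      linear_combination 2 * hi - 2 * lam * hE

/-- Integration over `[-1, 1]` against the Gegenbauer weight. -/
noncomputable def gegenbauerIntegral (lam : ℝ) (f : ℝ → ℝ) : ℝ :=
  ∫ x in (-1 : ℝ)..1, (1 - x ^ 2) ^ (lam - 1 / 2) * f x

lemma continuous_gegenbauerWeight {lam : ℝ} (hl : 1 / 2 ≤ lam) :
    Continuous fun x : ℝ => (1 - x ^ 2) ^ (lam - 1 / 2) :=
  (by fun_prop : Continuous fun x : ℝ => 1 - x ^ 2).rpow_const fun _ => Or.inr (by linarith)

lemma gegenbauerIntegral_of_linear {lam a b : ℝ} (hl : 1 / 2 ≤ lam) {f g h : ℝ → ℝ}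
    (hg : Continuous g) (hh : Continuous h) (hf : ∀ x, f x = a * g x - b * h x) :
    gegenbauerIntegral lam f = a * gegenbauerIntegral lam g - b * gegenbauerIntegral lam h := by
  have hw := continuous_gegenbauerWeight hl
  unfold gegenbauerIntegral
  rw [← intervalIntegral.integral_const_mul, ← intervalIntegral.integral_const_mul,
    ← intervalIntegral.integral_sub]
  · refine intervalIntegral.integral_congr fun x _ => ?_
    simp only [hf]; ring
  · exact (continuous_const.mul (hw.mul hg)).intervalIntegrable _ _
  · exact (continuous_const.mul (hw.mul hh)).intervalIntegrable _ _

lemma gegenbauerIntegral_by_parts {lam : ℝ} (hl : 1 / 2 ≤ lam) {f f' : ℝ → ℝ}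
    (hf : ∀ x, HasDerivAt f (f' x) x) (hf' : Continuous f') :
    gegenbauerIntegral lam (fun x => (1 - x ^ 2) * f' x) =
      (2 * lam + 1) * gegenbauerIntegral lam (fun x => x * f x) := by
  have hw := continuous_gegenbauerWeight hl
  have hfc : Continuous f := continuous_iff_continuousAt.2 fun x => (hf x).continuousAt
  have key : gegenbauerIntegral lam
      (fun x => (1 - x ^ 2) * f' x - (2 * lam + 1) * (x * f x)) = 0 := by
    unfold gegenbauerIntegral
    rw [intervalIntegral.integral_eq_sub_of_hasDerivAt
      (f := fun x => (1 - x ^ 2) ^ (lam + 1 / 2) * f x)]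
    · have : lam + 1 / 2 ≠ 0 := by linarith
      norm_num [Real.zero_rpow this]
    · intro x hx
      rw [Set.uIcc_of_le (by norm_num)] at hx
      have hx1 : 0 ≤ 1 - x ^ 2 := by nlinarith [hx.1, hx.2]
      have h1 : HasDerivAt (fun x : ℝ => 1 - x ^ 2) (-(2 * x)) x := by
        simpa using (hasDerivAt_pow 2 x).const_sub 1
      have h2 := (h1.rpow_const (p := lam + 1 / 2) (Or.inr (by linarith))).mul (hf x)
      refine h2.congr_deriv ?_
      have e1 : lam + 1 / 2 = (lam - 1 / 2) + 1 := by ring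
      have e2 : lam + 1 / 2 - 1 = lam - 1 / 2 := by ring
      rw [e2, e1, Real.rpow_add_one' hx1 (by linarith)]
      ring
    · exact (hw.mul (by fun_prop)).intervalIntegrable _ _
  rw [gegenbauerIntegral_of_linear (a := 1) (b := 2 * lam + 1) hl (g := fun x => (1 - x ^ 2) * f' x)
    (h := fun x => x * f x) (by fun_prop) (by fun_prop) (fun x => by ring)] at key
  linarith

lemma gegenbauerIntegral_succ {lam : ℝ} (hl : 1 / 2 ≤ lam) (n : ℕ) :
    gegenbauerIntegral lam (gegenbauer lam (n + 1)) = 0 := by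
  have hc := continuous_gegenbauer lam
  have hc' := continuous_gegenbauer (lam + 1)
  induction n using Nat.strong_induction_on with
  | _ n ih =>
  match n, ih with
  | 0, _ =>
    have h := gegenbauerIntegral_by_parts hl (f := fun _ => 1) (f' := fun _ => 0)
      (fun x => hasDerivAt_const x 1) continuous_const
    have h0 : gegenbauerIntegral lam (fun x => (1 - x ^ 2) * 0) = 0 := by simp [gegenbauerIntegral]
    rw [h0] at h
    have h1 := (mul_eq_zero.1 h.symm).resolve_left (by linarith)
    rw [gegenbauerIntegral_of_linear hl (f := gegenbauer lam (0 + 1)) (a := 2 * lam) (b := 0)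
      (g := fun x => x * 1) (h := fun _ => 0) (by fun_prop) (by fun_prop)
      (fun x => by simp [gegenbauer]), h1]
    ring
  | (n + 1), ih =>
    have hp := gegenbauerIntegral_by_parts hl (hasDerivAt_gegenbauer lam · n)
      (continuous_const.mul (hc' n))
    rw [gegenbauerIntegral_of_linear hl (g := fun t => t * gegenbauer lam (n + 1) t)
      (h := gegenbauer lam (n + 2)) (continuous_id.mul (hc _)) (hc _)
      (one_sub_sq_mul_gegenbauer lam · n)] at hp
    have hR := gegenbauerIntegral_of_linear hl (f := fun t => ((n : ℝ) + 2) * gegenbauer lam (n + 2) t)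
      (g := fun t => t * gegenbauer lam (n + 1) t) (h := gegenbauer lam n)
      (a := 2 * ((n : ℝ) + 1 + lam)) (b := (n : ℝ) + 2 * lam)
      (continuous_id.mul (hc _)) (hc _) (fun t => by rw [gegenbauer_rec]; ring)
    have hS := gegenbauerIntegral_of_linear hl (f := fun t => ((n : ℝ) + 2) * gegenbauer lam (n + 2) t)
      (g := gegenbauer lam (n + 2)) (h := fun _ => 0)
      (a := (n : ℝ) + 2) (b := 0) (hc _) continuous_const (fun t => by ring)
    rw [hS] at hR
    have hn : (n : ℝ) + 2 ≠ 0 := by positivity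
    apply mul_left_cancel₀ hn
    match n, ih with
    | 0, _ => push_cast at hp ⊢; linear_combination -hp
    | (m + 1), ih =>
      rw [ih m (by omega)] at hR
      push_cast at hp hR ⊢
      have hz : ((m : ℝ) + 3 + 2 * lam) * gegenbauerIntegral lam
          (fun t => t * gegenbauer lam (m + 1 + 1) t) = 0 := by
        linear_combination -hR - hp
      have hz' := (mul_eq_zero.1 hz).resolve_left (by positivity)
      rw [hz'] at hp
      linear_combination -hp

lemma gegenbauerIntegral_orthogonal_of_lt {lam : ℝ} (hl : 1 / 2 ≤ lam) (m n : ℕ) (hmn : m < n) :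
    gegenbauerIntegral lam (fun x => gegenbauer lam m x * gegenbauer lam n x) = 0 := by
  have hc := continuous_gegenbauer lam
  induction m using Nat.strong_induction_on generalizing n with
  | _ m ih =>
  match m, ih with
  | 0, _ =>
    obtain ⟨n, rfl⟩ := Nat.exists_eq_succ_of_ne_zero hmn.ne'
    simpa [gegenbauer] using gegenbauerIntegral_succ hl n
  | (m + 1), ih =>
    obtain ⟨n, rfl⟩ : ∃ p, n = p + 2 := ⟨n - 2, by omega⟩
    have h1 := ih m (by omega) (n + 1) (by omega)
    have h3 := ih m (by omega) (n + 3) (by omega)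
    have hn : 2 * ((n : ℝ) + 2 + lam) ≠ 0 := by positivity
    have hx : gegenbauerIntegral lam
        (fun x => x * gegenbauer lam m x * gegenbauer lam (n + 2) x) = 0 := by
      rw [gegenbauerIntegral_of_linear hl
        (g := fun x => gegenbauer lam m x * gegenbauer lam (n + 3) x)
        (h := fun x => gegenbauer lam m x * gegenbauer lam (n + 1) x)
        (a := ((n : ℝ) + 3) / (2 * ((n : ℝ) + 2 + lam)))
        (b := -(((n : ℝ) + 1 + 2 * lam) / (2 * ((n : ℝ) + 2 + lam))))
        ((hc _).mul (hc _)) ((hc _).mul (hc _)), h1, h3]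
      · ring
      · intro x
        have hR := gegenbauer_rec lam (n + 1) x
        push_cast at hR
        field_simp
        linear_combination -gegenbauer lam m x * hR
    match m, ih with
    | 0, _ =>
      rw [gegenbauerIntegral_of_linear hl
        (g := fun x => x * gegenbauer lam 0 x * gegenbauer lam (n + 2) x)
        (h := fun _ => 0) (a := 2 * lam) (b := 0)
        ((continuous_id.mul (hc _)).mul (hc _)) continuous_const, hx]
      · ring
      · intro x
        simp only [gegenbauer]; ring
    | (m + 1), ih =>
      have h2 := ih m (by omega) (n + 2) (by omega)
      have hm : (m : ℝ) + 2 ≠ 0 := by positivity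
      rw [gegenbauerIntegral_of_linear hl
        (g := fun x => x * gegenbauer lam (m + 1) x * gegenbauer lam (n + 2) x)
        (h := fun x => gegenbauer lam m x * gegenbauer lam (n + 2) x)
        (a := 2 * ((m : ℝ) + 1 + lam) / ((m : ℝ) + 2)) (b := ((m : ℝ) + 2 * lam) / ((m : ℝ) + 2))
        ((continuous_id.mul (hc _)).mul (hc _)) ((hc _).mul (hc _)), hx, h2]
      · ring
      · intro x
        have hR := gegenbauer_rec lam m x
        field_simp
        linear_combination gegenbauer lam (n + 2) x * hR

lemma gegenbauerIntegral_orthogonal {lam : ℝ} (hl : 1 / 2 ≤ lam) {m n : ℕ} (hmn : m ≠ n) :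
    gegenbauerIntegral lam (fun x => gegenbauer lam m x * gegenbauer lam n x) = 0 := by
  rcases lt_or_gt_of_ne hmn with h | h
  · exact gegenbauerIntegral_orthogonal_of_lt hl m n h
  · simpa only [mul_comm] using gegenbauerIntegral_orthogonal_of_lt hl n m h

lemma gegenbauerIntegral_id_mul_zero {lam : ℝ} (hl : 1 / 2 ≤ lam) (n : ℕ) :
    gegenbauerIntegral lam (fun x => x * gegenbauer lam 0 x * gegenbauer lam n x) =
      1 / (2 * lam) *
        gegenbauerIntegral lam (fun x => gegenbauer lam 1 x * gegenbauer lam n x) := by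
  have hc := continuous_gegenbauer lam
  have h0 : lam ≠ 0 := by linarith
  rw [gegenbauerIntegral_of_linear hl
    (g := fun x => gegenbauer lam 1 x * gegenbauer lam n x)
    (h := fun _ => 0) (a := 1 / (2 * lam)) (b := 0) ((hc _).mul (hc _)) continuous_const]
  · ring
  · intro x
    simp only [gegenbauer]
    field_simp
    ring

lemma gegenbauerIntegral_id_mul_succ {lam : ℝ} (hl : 1 / 2 ≤ lam) (m n : ℕ) :
    2 * ((m : ℝ) + 1 + lam) *
        gegenbauerIntegral lam (fun x => x * gegenbauer lam (m + 1) x * gegenbauer lam n x) =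
      ((m : ℝ) + 2) *
          gegenbauerIntegral lam (fun x => gegenbauer lam (m + 2) x * gegenbauer lam n x)
        + ((m : ℝ) + 2 * lam) *
          gegenbauerIntegral lam (fun x => gegenbauer lam m x * gegenbauer lam n x) := by
  have hc := continuous_gegenbauer lam
  have hm : (m : ℝ) + 1 + lam ≠ 0 := by positivity
  rw [gegenbauerIntegral_of_linear hl (a := ((m : ℝ) + 2) / (2 * ((m : ℝ) + 1 + lam)))
    (b := -(((m : ℝ) + 2 * lam) / (2 * ((m : ℝ) + 1 + lam))))
    (g := fun x => gegenbauer lam (m + 2) x * gegenbauer lam n x)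
    (h := fun x => gegenbauer lam m x * gegenbauer lam n x)
    ((hc _).mul (hc _)) ((hc _).mul (hc _))]
  · field_simp
    ring
  · intro x
    have hR := gegenbauer_rec lam m x
    field_simp
    linear_combination -gegenbauer lam n x * hR

lemma gegenbauerIntegral_id_mul_eq_zero {lam : ℝ} (hl : 1 / 2 ≤ lam) {m n : ℕ}
    (h1 : n ≠ m + 1) (h2 : n + 1 ≠ m) :
    gegenbauerIntegral lam (fun x => x * gegenbauer lam m x * gegenbauer lam n x) = 0 := by
  match m with
  | 0 =>
    rw [gegenbauerIntegral_id_mul_zero hl, gegenbauerIntegral_orthogonal hl (by omega), mul_zero]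
  | m + 1 =>
    have h := gegenbauerIntegral_id_mul_succ hl m n
    rw [gegenbauerIntegral_orthogonal hl (by omega), gegenbauerIntegral_orthogonal hl (by omega)]
      at h
    have hm : 2 * ((m : ℝ) + 1 + lam) ≠ 0 := by positivity
    simpa [hm] using h

lemma gegenbauerIntegral_id_mul_adjacent {lam : ℝ} (hl : 1 / 2 ≤ lam) (n : ℕ) :
    2 * ((n : ℝ) + lam) *
        gegenbauerIntegral lam (fun x => x * gegenbauer lam n x * gegenbauer lam (n + 1) x) =
      ((n : ℝ) + 1) *
        gegenbauerIntegral lam (fun x => gegenbauer lam (n + 1) x * gegenbauer lam (n + 1) x) := by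
  match n with
  | 0 =>
    have : lam ≠ 0 := by linarith
    rw [gegenbauerIntegral_id_mul_zero hl]
    push_cast
    field_simp
    ring
  | n + 1 =>
    have h := gegenbauerIntegral_id_mul_succ hl n (n + 2)
    rw [gegenbauerIntegral_orthogonal hl (m := n) (by omega)] at h
    push_cast
    linear_combination h

/-- The ratio of consecutive squared norms. -/
lemma gegenbauerIntegral_sq_succ {lam : ℝ} (hl : 1 / 2 ≤ lam) (n : ℕ) :
    ((n : ℝ) + 1) * ((n : ℝ) + 1 + lam) *
        gegenbauerIntegral lam (fun x => gegenbauer lam (n + 1) x * gegenbauer lam (n + 1) x) =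
      ((n : ℝ) + 2 * lam) * ((n : ℝ) + lam) *
        gegenbauerIntegral lam (fun x => gegenbauer lam n x * gegenbauer lam n x) := by
  have h := gegenbauerIntegral_id_mul_succ hl n n
  rw [gegenbauerIntegral_orthogonal hl (m := n + 2) (by omega)] at h
  have hadj := gegenbauerIntegral_id_mul_adjacent hl n
  have e : (fun x => x * gegenbauer lam (n + 1) x * gegenbauer lam n x) =
      fun x => x * gegenbauer lam n x * gegenbauer lam (n + 1) x := by ext; ring
  rw [e] at h
  linear_combination ((n : ℝ) + lam) * h - ((n : ℝ) + 1 + lam) * hadj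

/-- The equal-degree pairing between the families with parameters `lam` and `lam + 1`. -/
lemma gegenbauerIntegral_param_succ_same {lam : ℝ} (hl : 1 / 2 ≤ lam) (n : ℕ) :
    ((n : ℝ) + lam) *
        gegenbauerIntegral (lam + 1) (fun x => gegenbauer lam n x * gegenbauer (lam + 1) n x) =
      lam * gegenbauerIntegral (lam + 1)
        (fun x => gegenbauer (lam + 1) n x * gegenbauer (lam + 1) n x) := by
  have hc := continuous_gegenbauer (lam + 1)
  have hl' : 1 / 2 ≤ lam + 1 := by linarith
  match n with
  | 0 => simp [gegenbauer]
  | 1 =>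
    rw [gegenbauerIntegral_of_linear hl' (a := lam / (1 + lam)) (b := 0)
      (g := fun x => gegenbauer (lam + 1) 1 x * gegenbauer (lam + 1) 1 x) (h := fun _ => 0)
      ((hc _).mul (hc _)) continuous_const]
    · have : 1 + lam ≠ 0 := by linarith
      push_cast
      field_simp
      ring
    · intro x
      have : 1 + lam ≠ 0 := by linarith
      simp only [gegenbauer]
      field_simp
      ring
  | n + 2 =>
    have hn : (n : ℝ) + 2 + lam ≠ 0 := by positivity
    rw [gegenbauerIntegral_of_linear hl' (a := lam / (n + 2 + lam)) (b := lam / (n + 2 + lam))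
      (g := fun x => gegenbauer (lam + 1) (n + 2) x * gegenbauer (lam + 1) (n + 2) x)
      (h := fun x => gegenbauer (lam + 1) n x * gegenbauer (lam + 1) (n + 2) x)
      ((hc _).mul (hc _)) ((hc _).mul (hc _)), gegenbauerIntegral_orthogonal hl' (m := n) (by omega)]
    · push_cast
      field_simp
      ring
    · intro x
      have hi := gegenbauer_param_succ lam x n
      field_simp
      linear_combination gegenbauer (lam + 1) (n + 2) x * hi

lemma gegenbauerIntegral_param_succ_shift {lam : ℝ} (hl : 1 / 2 ≤ lam) (n : ℕ) :
    ((n : ℝ) + 2 + lam) *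
        gegenbauerIntegral (lam + 1)
          (fun x => gegenbauer (lam + 1) n x * gegenbauer lam (n + 2) x) =
      -lam * gegenbauerIntegral (lam + 1)
        (fun x => gegenbauer (lam + 1) n x * gegenbauer (lam + 1) n x) := by
  have hc := continuous_gegenbauer (lam + 1)
  have hl' : 1 / 2 ≤ lam + 1 := by linarith
  have hn : (n : ℝ) + 2 + lam ≠ 0 := by positivity
  rw [gegenbauerIntegral_of_linear hl' (a := lam / (n + 2 + lam)) (b := lam / (n + 2 + lam))
    (g := fun x => gegenbauer (lam + 1) (n + 2) x * gegenbauer (lam + 1) n x)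
    (h := fun x => gegenbauer (lam + 1) n x * gegenbauer (lam + 1) n x)
    ((hc _).mul (hc _)) ((hc _).mul (hc _)), gegenbauerIntegral_orthogonal hl' (m := n + 2) (by omega)]
  · field_simp
    ring
  · intro x
    have hi := gegenbauer_param_succ lam x n
    field_simp
    linear_combination gegenbauer (lam + 1) n x * hi

lemma gegenbauerIntegral_half_sq (n : ℕ) :
    gegenbauerIntegral (1 / 2) (fun x => gegenbauer (1 / 2) n x * gegenbauer (1 / 2) n x) =
      2 / (2 * (n : ℝ) + 1) := by
  induction n with
  | zero => norm_num [gegenbauer, gegenbauerIntegral]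
  | succ n ih =>
    have h := gegenbauerIntegral_sq_succ (le_refl (1 / 2 : ℝ)) n
    rw [ih] at h
    have h1 : (n : ℝ) + 1 ≠ 0 := by positivity
    have h2 : (n : ℝ) + 1 + 1 / 2 ≠ 0 := by positivity
    apply mul_left_cancel₀ (mul_ne_zero h1 h2)
    rw [h]
    push_cast
    field_simp

lemma gegenbauerIntegral_one_succ {lam : ℝ} (hl : 1 / 2 ≤ lam) :
    (2 * lam + 2) * gegenbauerIntegral (lam + 1) (fun _ => 1) =
      (2 * lam + 1) * gegenbauerIntegral lam (fun _ => 1) := by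
  have hp := gegenbauerIntegral_by_parts hl (f := fun x => x) (f' := fun _ => 1)
    (fun x => hasDerivAt_id x) continuous_const
  have h1 : gegenbauerIntegral (lam + 1) (fun _ => 1) =
      gegenbauerIntegral lam (fun x => (1 - x ^ 2) * 1) := by
    refine intervalIntegral.integral_congr fun x hx => ?_
    rw [Set.uIcc_of_le (by norm_num)] at hx
    have hx1 : 0 ≤ 1 - x ^ 2 := by nlinarith [hx.1, hx.2]
    have e : lam + 1 - 1 / 2 = (lam - 1 / 2) + 1 := by ring
    simp only [e]
    rw [Real.rpow_add_one' hx1 (by linarith)]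
    ring
  have h2 := gegenbauerIntegral_of_linear hl (f := fun x => (1 - x ^ 2) * 1) (g := fun _ => 1)
    (h := fun x => x * x) (a := 1) (b := 1) (by fun_prop) (by fun_prop) (fun x => by ring)
  rw [h1]
  linear_combination (2 * lam + 1) * h2 + hp

lemma gegenbauerIntegral_natCast_one (k : ℕ) :
    gegenbauerIntegral ((k : ℝ) + 1) (fun _ => 1) =
      π * (Nat.factorial (2 * k + 1) : ℝ) /
        (2 * 4 ^ k * ((k : ℝ) + 1) * (Nat.factorial k : ℝ) ^ 2) := by
  induction k with
  | zero =>
    have := integral_sqrt_one_sub_sq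
    simp only [Real.sqrt_eq_rpow] at this
    norm_num [gegenbauerIntegral] at this ⊢
    exact this
  | succ k ih =>
    have h := gegenbauerIntegral_one_succ (lam := (k : ℝ) + 1) (by linarith [k.cast_nonneg (α := ℝ)])
    rw [ih] at h
    have h1 : 2 * ((k : ℝ) + 1) + 2 ≠ 0 := by positivity
    push_cast
    apply mul_left_cancel₀ h1
    rw [h, show 2 * (k + 1) + 1 = 2 * k + 1 + 1 + 1 by ring, Nat.factorial_succ (2 * k + 1 + 1),
      Nat.factorial_succ (2 * k + 1), Nat.factorial_succ k]
    push_cast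
    field_simp
    ring

lemma gegenbauerIntegral_natCast_sq (k m : ℕ) :
    gegenbauerIntegral ((k : ℝ) + 1)
        (fun x => gegenbauer ((k : ℝ) + 1) m x * gegenbauer ((k : ℝ) + 1) m x) =
      π * (Nat.factorial (m + 2 * k + 1) : ℝ) /
        (2 * 4 ^ k * ((m : ℝ) + k + 1) * (Nat.factorial k : ℝ) ^ 2 * (Nat.factorial m : ℝ)) := by
  induction m with
  | zero =>
    have := gegenbauerIntegral_natCast_one k
    simpa [gegenbauer] using this
  | succ m ih =>
    have h := gegenbauerIntegral_sq_succ (lam := (k : ℝ) + 1)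
      (by linarith [k.cast_nonneg (α := ℝ)]) m
    rw [ih] at h
    have h1 : ((m : ℝ) + 1) * ((m : ℝ) + 1 + (k + 1)) ≠ 0 := by positivity
    apply mul_left_cancel₀ h1
    rw [h, show m + 1 + 2 * k + 1 = m + 2 * k + 1 + 1 by ring,
      Nat.factorial_succ (m + 2 * k + 1), Nat.factorial_succ m]
    push_cast
    field_simp
    ring

lemma measurableSet_unitDisk : MeasurableSet unitDisk :=
  measurableSet_lt (by fun_prop) (by fun_prop)

lemma unitDisk_subset : unitDisk ⊆ Set.Icc (-1 : ℝ) 1 ×ˢ Set.Icc (-1 : ℝ) 1 := by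
  rintro ⟨x, y⟩ h
  simp only [unitDisk, Set.mem_ofPred_eq] at h
  refine ⟨⟨?_, ?_⟩, ?_, ?_⟩ <;> dsimp only <;> nlinarith [sq_nonneg x, sq_nonneg y]

lemma volume_unitDisk_ne_top : volume unitDisk ≠ ⊤ :=
  ((isCompact_Icc.prod isCompact_Icc).measure_lt_top.trans_le' (measure_mono unitDisk_subset)).ne

/-- Fubini on the unit disk, with every vertical fibre rescaled to `[-1, 1]`. -/
lemma setIntegral_unitDisk {F : ℝ × ℝ → ℝ} (hF : IntegrableOn F unitDisk) :
    ∫ p in unitDisk, F p = ∫ x in (-1 : ℝ)..1,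
      √(1 - x ^ 2) * ∫ u in (-1 : ℝ)..1, F (x, u * √(1 - x ^ 2)) := by
  rw [← integral_indicator measurableSet_unitDisk, Measure.volume_eq_prod, integral_prod _
    (by rw [← Measure.volume_eq_prod]; exact hF.integrable_indicator measurableSet_unitDisk),
    intervalIntegral.integral_of_le (by norm_num), integral_Ioc_eq_integral_Ioo,
    ← integral_indicator measurableSet_Ioo]
  congr 1
  ext x
  by_cases hx : x ∈ Set.Ioo (-1 : ℝ) 1
  · have hx1 : 0 < 1 - x ^ 2 := by nlinarith [hx.1, hx.2]
    have hs : 0 < √(1 - x ^ 2) := Real.sqrt_pos.2 hx1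
    rw [Set.indicator_of_mem hx, ← smul_eq_mul,
      intervalIntegral.smul_integral_comp_mul_right (fun y => F (x, y)),
      intervalIntegral.integral_of_le (by linarith), integral_Ioc_eq_integral_Ioo,
      ← integral_indicator measurableSet_Ioo]
    congr 1
    ext y
    have : (x, y) ∈ unitDisk ↔ y ∈ Set.Ioo (-1 * √(1 - x ^ 2)) (1 * √(1 - x ^ 2)) := by
      rw [Set.mem_Ioo, neg_one_mul, one_mul, ← abs_lt, Real.lt_sqrt (abs_nonneg y), sq_abs]
      simp only [unitDisk, Set.mem_ofPred_eq]
      exact lt_sub_iff_add_lt'.symm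
    by_cases hy : (x, y) ∈ unitDisk
    · rw [Set.indicator_of_mem hy, Set.indicator_of_mem (this.1 hy)]
    · rw [Set.indicator_of_notMem hy, Set.indicator_of_notMem (mt this.2 hy)]
  · rw [Set.indicator_of_notMem hx]
    have : ∀ y, unitDisk.indicator F (x, y) = 0 := fun y =>
      Set.indicator_of_notMem (fun h => hx ?_) _
    · simp [this]
    · simp only [unitDisk, Set.mem_ofPred_eq] at h
      constructor <;> nlinarith [sq_nonneg y, sq_nonneg x]

lemma measurable_Q2 (n k : ℕ) : Measurable fun p : ℝ × ℝ => Q2 n k p.1 p.2 := by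
  have h1 := (continuous_gegenbauer ((k : ℝ) + 1) (n - k)).measurable
  have h2 := (continuous_gegenbauer (1 / 2) k).measurable
  unfold Q2
  fun_prop

lemma exists_Q2_bound (n k : ℕ) :
    ∃ M, ∀ p ∈ unitDisk, |Q2 n k p.1 p.2| ≤ M := by
  obtain ⟨A, hA⟩ := isCompact_Icc.exists_bound_of_continuousOn
    (continuous_gegenbauer ((k : ℝ) + 1) (n - k)).continuousOn (s := Set.Icc (-1 : ℝ) 1)
  obtain ⟨B, hB⟩ := isCompact_Icc.exists_bound_of_continuousOn
    (continuous_gegenbauer (1 / 2) k).continuousOn (s := Set.Icc (-1 : ℝ) 1)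
  refine ⟨|1 / hConst k n| * A * 1 * B, ?_⟩
  rintro ⟨x, y⟩ hp
  have hx := (unitDisk_subset hp).1
  simp only [unitDisk, Set.mem_ofPred_eq] at hp
  have hx1 : 0 < 1 - x ^ 2 := by nlinarith [sq_nonneg y]
  have hs : 0 < √(1 - x ^ 2) := Real.sqrt_pos.2 hx1
  have hu : y / √(1 - x ^ 2) ∈ Set.Icc (-1 : ℝ) 1 := by
    rw [Set.mem_Icc, ← abs_le, abs_div, abs_of_pos hs, div_le_one hs]
    exact Real.abs_le_sqrt (by linarith)
  have hA0 : 0 ≤ A := (norm_nonneg _).trans (hA x hx)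
  have hw : |(1 - x ^ 2) ^ ((k : ℝ) / 2)| ≤ 1 := by
    rw [abs_of_nonneg (by positivity)]
    exact Real.rpow_le_one hx1.le (by nlinarith [sq_nonneg x]) (by positivity)
  simp only [Q2, abs_mul]
  gcongr
  · exact hA x hx
  · exact hB _ hu

lemma integrableOn_snd_mul_Q2_mul_Q2 (n k m j : ℕ) :
    IntegrableOn (fun p : ℝ × ℝ => p.2 * Q2 n k p.1 p.2 * Q2 m j p.1 p.2) unitDisk := by
  obtain ⟨A, hA⟩ := exists_Q2_bound n k
  obtain ⟨B, hB⟩ := exists_Q2_bound m j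
  refine Measure.integrableOn_of_bounded (M := 1 * A * B) volume_unitDisk_ne_top
    ((measurable_snd.mul (measurable_Q2 n k)).mul (measurable_Q2 m j)).aestronglyMeasurable ?_
  filter_upwards [ae_restrict_mem measurableSet_unitDisk] with p hp
  have hA0 : 0 ≤ A := (abs_nonneg _).trans (hA p hp)
  rw [Real.norm_eq_abs, abs_mul, abs_mul]
  gcongr
  · exact abs_le.2 (unitDisk_subset hp).2
  · exact hA p hp
  · exact hB p hp

/-- Separation of variables for the matrix entries of multiplication by `y`. -/
lemma setIntegral_snd_mul_Q2_mul_Q2 (n k m j : ℕ) {lam : ℝ}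
    (hl : lam = ((k : ℝ) + j + 3) / 2) :
    ∫ p in unitDisk, p.2 * Q2 n k p.1 p.2 * Q2 m j p.1 p.2 =
      1 / hConst k n * (1 / hConst j m) *
        gegenbauerIntegral lam
          (fun x => gegenbauer ((k : ℝ) + 1) (n - k) x * gegenbauer ((j : ℝ) + 1) (m - j) x) *
        gegenbauerIntegral (1 / 2)
          (fun u => u * gegenbauer (1 / 2) k u * gegenbauer (1 / 2) j u) := by
  rw [setIntegral_unitDisk (integrableOn_snd_mul_Q2_mul_Q2 n k m j)]
  simp only [gegenbauerIntegral]
  rw [mul_right_comm, ← intervalIntegral.integral_const_mul,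
    intervalIntegral.integral_of_le (by norm_num), intervalIntegral.integral_of_le (by norm_num),
    integral_Ioc_eq_integral_Ioo, integral_Ioc_eq_integral_Ioo]
  refine setIntegral_congr_fun measurableSet_Ioo fun x hx => ?_
  have hx1 : 0 < 1 - x ^ 2 := by nlinarith [hx.1, hx.2]
  have hs : 0 < √(1 - x ^ 2) := Real.sqrt_pos.2 hx1
  have hw : (1 - x ^ 2) ^ (lam - 1 / 2) = √(1 - x ^ 2) * √(1 - x ^ 2) *
      (1 - x ^ 2) ^ ((k : ℝ) / 2) * (1 - x ^ 2) ^ ((j : ℝ) / 2) := by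
    rw [Real.sqrt_eq_rpow, ← Real.rpow_add hx1, ← Real.rpow_add hx1, ← Real.rpow_add hx1, hl]
    congr 1
    ring
  simp only [Q2, mul_div_cancel_right₀ _ hs.ne', hw, sub_self, Real.rpow_zero, one_mul]
  rw [mul_right_comm (1 / hConst k n * (1 / hConst j m)), ← intervalIntegral.integral_const_mul,
    ← intervalIntegral.integral_const_mul]
  refine intervalIntegral.integral_congr fun u _ => ?_
  ring

lemma hConst_sq (k m : ℕ) :
    hConst k (k + m) ^ 2 = π / 4 ^ k * (Nat.factorial (m + 2 * k + 1) : ℝ) /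
      (((k : ℝ) + m + 1) * (2 * (k : ℝ) + 1) * (Nat.factorial k : ℝ) ^ 2 *
        (Nat.factorial m : ℝ)) := by
  rw [hConst, Real.sq_sqrt (by positivity), Nat.add_sub_cancel_left,
    show k + m + k + 1 = m + 2 * k + 1 by ring, Nat.cast_add]

lemma hConst_pos (k n : ℕ) : 0 < hConst k n := by
  rw [hConst]
  positivity

lemma gegenbauerIntegral_eq_hConst_sq (k m : ℕ) :
    gegenbauerIntegral ((k : ℝ) + 1)
        (fun x => gegenbauer ((k : ℝ) + 1) m x * gegenbauer ((k : ℝ) + 1) m x) =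
      (2 * (k : ℝ) + 1) / 2 * hConst k (k + m) ^ 2 := by
  rw [gegenbauerIntegral_natCast_sq, hConst_sq]
  field_simp
  ring

lemma gegenbauerIntegral_legendre_adjacent (k : ℕ) :
    gegenbauerIntegral (1 / 2)
        (fun u => u * gegenbauer (1 / 2) k u * gegenbauer (1 / 2) (k + 1) u) =
      2 * ((k : ℝ) + 1) / ((2 * (k : ℝ) + 1) * (2 * (k : ℝ) + 3)) := by
  have h := gegenbauerIntegral_id_mul_adjacent (le_refl (1 / 2 : ℝ)) k
  rw [gegenbauerIntegral_half_sq] at h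
  have h1 : 2 * ((k : ℝ) + 1 / 2) ≠ 0 := by positivity
  apply mul_left_cancel₀ h1
  rw [h]
  push_cast
  field_simp
  ring

lemma hConst_ratio_dCoef (k m : ℕ) :
    hConst (k + 1) (k + 1 + m) / hConst k (k + m) *
        (((k : ℝ) + 1) ^ 2 / (((k : ℝ) + m + 1) * (2 * (k : ℝ) + 1))) =
      dCoef k ((k + m : ℕ) : ℤ) := by
  have h0 := hConst_pos k (k + m)
  have h1 := hConst_pos (k + 1) (k + 1 + m)
  refine (sq_eq_sq₀ (by positivity) (by rw [dCoef]; positivity)).1 ?_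
  rw [dCoef, mul_pow, div_pow, hConst_sq, hConst_sq, mul_pow, Real.sq_sqrt (by positivity),
    show m + 2 * (k + 1) + 1 = m + 2 * k + 1 + 1 + 1 by ring, Nat.factorial_succ (m + 2 * k + 1 + 1),
    Nat.factorial_succ (m + 2 * k + 1), Nat.factorial_succ k]
  push_cast
  field_simp
  ring

lemma hConst_ratio_cCoef (k m : ℕ) :
    -(hConst (k + 1) (k + 1 + m) / hConst k (k + (m + 2)) *
        (((k : ℝ) + 1) ^ 2 / (((k : ℝ) + m + 3) * (2 * (k : ℝ) + 1)))) =
      cCoef ((k + 1 : ℕ) : ℤ) ((k + 1 + m : ℕ) : ℤ) := by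
  have h0 := hConst_pos k (k + (m + 2))
  have h1 := hConst_pos (k + 1) (k + 1 + m)
  rw [cCoef, neg_mul, neg_inj]
  refine (sq_eq_sq₀ (by positivity) (by positivity)).1 ?_
  have e1 : 2 * (((k + 1 : ℕ) : ℤ) : ℝ) - 1 = 2 * (k : ℝ) + 1 := by push_cast; ring
  have e2 : (((k + 1 + m : ℕ) : ℤ) : ℝ) - (((k + 1 : ℕ) : ℤ) : ℝ) = (m : ℝ) := by push_cast; ring
  rw [mul_pow, div_pow, hConst_sq, hConst_sq, mul_pow, e1, e2, Real.sq_sqrt (by positivity),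
    show m + 2 * (k + 1) + 1 = m + 2 * k + 3 by ring,
    show m + 2 + 2 * k + 1 = m + 2 * k + 3 by ring, Nat.factorial_succ (m + 1),
    Nat.factorial_succ m, Nat.factorial_succ k]
  push_cast
  field_simp
  ring

/-- the matrix `A_{n,2}` is banded, with entries `d_{k,n}` on the
superdiagonal `j = k + 1` and `c_{k,n}` on the subdiagonal `j = k - 1`. -/
theorem A_n2_banded (n k j : ℕ) (hk : k ≤ n) (hj : j ≤ n + 1) :
    (∫ p in unitDisk, p.2 * Q2 n k p.1 p.2 * Q2 (n + 1) j p.1 p.2) =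
      if j = k + 1 then dCoef k n else if j + 1 = k then cCoef k n else 0 := by
  rcases eq_or_ne j (k + 1) with rfl | h1
  · obtain ⟨m, rfl⟩ := Nat.exists_eq_add_of_le hk
    have hX := gegenbauerIntegral_param_succ_same (lam := (k : ℝ) + 1)
      (by linarith [k.cast_nonneg (α := ℝ)]) m
    have hN := gegenbauerIntegral_eq_hConst_sq (k + 1) m
    have hH := hConst_pos (k + 1) (k + 1 + m)
    have hH' := hConst_pos k (k + m)
    rw [if_pos rfl, ← hConst_ratio_dCoef, setIntegral_snd_mul_Q2_mul_Q2 _ _ _ _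
      (lam := (k : ℝ) + 1 + 1) (by push_cast; ring), gegenbauerIntegral_legendre_adjacent,
      show k + m + 1 = k + 1 + m by ring, Nat.add_sub_cancel_left, Nat.add_sub_cancel_left]
    push_cast at hN ⊢
    rw [hN] at hX
    rw [eq_div_of_mul_eq (by positivity) ((mul_comm _ _).trans hX)]
    field_simp
    ring
  rw [if_neg h1]
  rcases eq_or_ne (j + 1) k with rfl | h2
  · obtain ⟨m, rfl⟩ := Nat.exists_eq_add_of_le hk
    have hX := gegenbauerIntegral_param_succ_shift (lam := (j : ℝ) + 1)
      (by linarith [j.cast_nonneg (α := ℝ)]) m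
    have hN := gegenbauerIntegral_eq_hConst_sq (j + 1) m
    have hH := hConst_pos (j + 1) (j + 1 + m)
    have hH' := hConst_pos j (j + (m + 2))
    have hL : gegenbauerIntegral (1 / 2)
        (fun u => u * gegenbauer (1 / 2) (j + 1) u * gegenbauer (1 / 2) j u) =
        2 * ((j : ℝ) + 1) / ((2 * (j : ℝ) + 1) * (2 * (j : ℝ) + 3)) := by
      rw [← gegenbauerIntegral_legendre_adjacent]
      congr 1
      ext u
      ring
    rw [if_pos rfl, ← hConst_ratio_cCoef, setIntegral_snd_mul_Q2_mul_Q2 _ _ _ _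
      (lam := (j : ℝ) + 1 + 1) (by push_cast; ring), hL,
      show j + 1 + m + 1 = j + (m + 2) by ring, Nat.add_sub_cancel_left, Nat.add_sub_cancel_left]
    push_cast at hN ⊢
    rw [hN] at hX
    rw [eq_div_of_mul_eq (by positivity) ((mul_comm _ _).trans hX)]
    field_simp
    ring
  · rw [if_neg h2, setIntegral_snd_mul_Q2_mul_Q2 _ _ _ _ rfl,
      gegenbauerIntegral_id_mul_eq_zero le_rfl h1 h2, mul_zero]
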